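/- arXiv:2002.03615 — 2 statements merged into one kernel-verified Lean document; each statement's English description precedes it below -/
import Mathlib

section
/- Let g be an element of PGL₃(ℂ), acting on the complex projective plane ℙ²(ℂ), and let d be any metric on ℙ²(ℂ) inducing its topology. Then hpol(g) = 0 if and only if g is represented by a matrix of GL₃(ℂ) that is conjugate to a unitary matrix (equivalently, g is conjugate in PGL₃(ℂ) to an element of PU₃(ℂ), i.e. g is an isometry for some Fubini–Study metric). -/
open Filter Topology Metric
open scoped ENNReal

variable {X : Type*}

/-- Minimal number of balls of radius `ε` for the Bowen metric
`d_n^f(x,y) = max_{0 ≤ j ≤ n-1} dist (f^[j] x) (f^[j] y)` needed to cover `X`. -/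
noncomputable def covNum [PseudoMetricSpace X] (f : X → X) (ε : ℝ) (n : ℕ) : ℕ :=
  sInf {m : ℕ | ∃ S : Finset X, S.card = m ∧
    ∀ x : X, ∃ s ∈ S, ∀ j < n, dist (f^[j] x) (f^[j] s) < ε}

/-- The polynomial entropy `hpol f = lim_{ε → 0} limsup_n log (Cov_ε(n)) / log n`,
with values in `[0,+∞]`.  Since `ε ↦ limsup_n log (Cov_ε(n)) / log n` is antitone,
the limit as `ε → 0` is the supremum over `ε > 0`. -/
noncomputable def hpol [PseudoMetricSpace X] (f : X → X) : ℝ≥0∞ :=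
  ⨆ (ε : ℝ) (_ : 0 < ε),
    Filter.atTop.limsup fun n : ℕ =>
      ENNReal.ofReal (Real.log (covNum f ε n) / Real.log n)

/-- The complex projective space `ℙ^{n-1}(ℂ) = P(ℂ^n)`, i.e. the projectivization of
`ℂ^n`, carries the quotient topology (of the subspace `ℂ^n \ {0}`). -/
noncomputable instance (n : ℕ) : TopologicalSpace (Projectivization ℂ (Fin n → ℂ)) :=
  instTopologicalSpaceQuotient

open Classical in
/-- The projective transformation of `P(ℂ^n)` induced by a matrix `A` (through the
linear map `y ↦ A.mulVec y`); it is the identity if `A` is not injective (in all uses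
below, `A` is invertible). -/
noncomputable def projAction {n : ℕ} (A : Matrix (Fin n) (Fin n) ℂ) :
    Projectivization ℂ (Fin n → ℂ) → Projectivization ℂ (Fin n → ℂ) :=
  if h : Function.Injective (Matrix.toLin' A) then Projectivization.map (Matrix.toLin' A) h
  else id

/-- An element of `PGL_n(ℂ)` represented by the invertible matrix `A` is conjugate (in
`PGL_n(ℂ)`) to an element of `PU_n(ℂ)` iff some representative `c • A` (`c ≠ 0`) of its
class is conjugate in `GL_n(ℂ)` to a unitary matrix. -/
def IsProjectivelyUnitary {n : ℕ} (A : Matrix (Fin n) (Fin n) ℂ) : Prop :=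
  ∃ c : ℂ, c ≠ 0 ∧ ∃ C : Matrix (Fin n) (Fin n) ℂ, C.det ≠ 0 ∧
    C⁻¹ * (c • A) * C ∈ Matrix.unitaryGroup (Fin n) ℂ

theorem aux_mem {X : Type*} [t : TopologicalSpace X] [CompactSpace X] (dm : MetricSpace X)
    (h : dm.toUniformSpace.toTopologicalSpace = t) (f : X → X) (hf : Continuous f)
    (ε : ℝ) (hε : 0 < ε) (n : ℕ) :
    ∃ S : Finset X, S.card = covNum f ε n ∧
      ∀ x : X, ∃ s ∈ S, ∀ j < n, dist (f^[j] x) (f^[j] s) < ε := by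
  subst h
  suffices h : Set.Nonempty {m : ℕ | ∃ S : Finset X, S.card = m ∧
    ∀ x : X, ∃ s ∈ S, ∀ j < n, dist (f^[j] x) (f^[j] s) < ε} from Nat.sInf_mem h
  have hop : ∀ s : X, IsOpen {x | ∀ j < n, dist (f^[j] x) (f^[j] s) < ε} := by
    intro s
    have : {x | ∀ j < n, dist (f^[j] x) (f^[j] s) < ε} =
        ⋂ j ∈ Finset.range n, {x | dist (f^[j] x) (f^[j] s) < ε} := by
      ext x; simp
    rw [this]
    refine isOpen_biInter_finset fun j _ => ?_
    exact isOpen_lt ((hf.iterate j).dist continuous_const) continuous_const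
  obtain ⟨T, hT⟩ := isCompact_univ.elim_finite_subcover _ hop
    (fun x _ => Set.mem_iUnion.2 ⟨x, fun j _ => by simpa using hε⟩)
  refine ⟨_, T, rfl, fun x => ?_⟩
  have := hT (Set.mem_univ x)
  simpa using this

theorem aux_lower {X : Type*} [t : TopologicalSpace X] [CompactSpace X] (dm : MetricSpace X)
    (h : dm.toUniformSpace.toTopologicalSpace = t) (f : X → X) (hf : Continuous f)
    (hs : Function.Surjective f) (x y : X) (hxy : y ≠ x)
    (hlim : Tendsto (fun k : ℕ => f^[k] x) atTop (𝓝 y)) : hpol f ≠ 0 := by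
  have hmem := aux_mem dm h f hf
  subst h
  have hper : ∀ p : ℕ, 0 < p → f^[p] x ≠ x := by
    intro p hp hpx
    have h1 : Tendsto (fun k : ℕ => f^[p * k] x) atTop (𝓝 y) :=
      hlim.comp (tendsto_id.const_mul_atTop' hp)
    have h2 : ∀ k : ℕ, f^[p * k] x = x := by
      intro k
      rw [Function.iterate_mul]
      exact Function.iterate_fixed hpx k
    simp only [h2] at h1
    exact hxy (tendsto_nhds_unique h1 tendsto_const_nhds)
  obtain ⟨ε, hε, hsep⟩ : ∃ ε : ℝ, 0 < ε ∧ ∀ k : ℕ, 0 < k → ε ≤ dist (f^[k] x) x := by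
    have hd : 0 < dist y x := dist_pos.2 hxy
    have h1 : ∀ᶠ k : ℕ in atTop, dist y x / 2 < dist (f^[k] x) x :=
      (hlim.dist tendsto_const_nhds).eventually_const_lt (by linarith)
    obtain ⟨K, hK⟩ := eventually_atTop.1 h1
    have h2 : ∀ᶠ ε : ℝ in 𝓝[>] 0, ∀ k ∈ Finset.Icc 1 K, ε < dist (f^[k] x) x := by
      rw [Filter.eventually_all_finset]
      intro k hk
      have : 0 < dist (f^[k] x) x := dist_pos.2 (hper k (Finset.mem_Icc.1 hk).1)
      exact nhdsWithin_le_nhds (eventually_lt_nhds this)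
    have h3 : ∀ᶠ ε : ℝ in 𝓝[>] 0, ε < dist y x / 2 :=
      nhdsWithin_le_nhds (eventually_lt_nhds (by linarith))
    have h4 : ∀ᶠ ε : ℝ in 𝓝[>] 0, 0 < ε := eventually_mem_nhdsWithin
    obtain ⟨ε, a, b, c⟩ := (h2.and (h3.and h4)).exists
    refine ⟨ε, c, fun k hk => ?_⟩
    rcases le_total k K with h | h
    · exact (a k (Finset.mem_Icc.2 ⟨hk, h⟩)).le
    · exact (b.trans (hK k h)).le
  have hcov : ∀ n : ℕ, n ≤ covNum f (ε / 2) n := by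
    intro n
    obtain ⟨S, hS, hSc⟩ := hmem (ε / 2) (by linarith) n
    choose z hz using fun k : ℕ => hs.iterate k x
    choose s hsS hsd using hSc
    rw [← hS]
    have := Finset.card_le_card_of_injOn (s := Finset.range n) (t := S) (fun k => s (z k))
      (fun k _ => hsS _) ?_
    · simpa using this
    have key : ∀ k l : ℕ, k < n → l < k → s (z k) = s (z l) → False := by
      intro k l hk hl he
      have h1 := hsd (z k) k hk
      have h2 := hsd (z l) k hk
      rw [← he] at h2
      have h3 : f^[k] (z l) = f^[k - l] x := by
        conv_lhs => rw [show k = (k - l) + l by omega, Function.iterate_add_apply, hz]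
      rw [hz] at h1
      rw [h3] at h2
      have h4 := hsep (k - l) (by omega)
      have h5 := dist_triangle_right (f^[k - l] x) x (f^[k] (s (z k)))
      linarith
    intro k hk l hl he
    simp only [Finset.coe_range, Set.mem_Iio] at hk hl
    rcases lt_trichotomy k l with h | h | h
    · exact (key l k hl h he.symm).elim
    · exact h
    · exact (key k l hk h he).elim
  intro h0
  have h1 : (1 : ℝ≥0∞) ≤ hpol f := by
    refine le_trans ?_ (le_iSup₂ (ε / 2) (by linarith))
    refine Filter.le_limsup_of_frequently_le' (Eventually.frequently ?_)
    filter_upwards [eventually_ge_atTop 2] with n hn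
    rw [← ENNReal.ofReal_one]
    apply ENNReal.ofReal_le_ofReal
    have hn' : (2 : ℝ) ≤ n := by exact_mod_cast hn
    rw [le_div_iff₀ (Real.log_pos (by linarith)), one_mul]
    exact Real.log_le_log (by linarith) (by exact_mod_cast hcov n)
  rw [h0] at h1
  simp at h1

theorem aux_upper {X : Type*} [t : TopologicalSpace X] [CompactSpace X] (dm : MetricSpace X)
    (h : dm.toUniformSpace.toTopologicalSpace = t) (f : X → X)
    {K : Type*} [TopologicalSpace K] [CompactSpace K] (F : K × X → X) (hF : Continuous F)
    (hfF : ∀ j : ℕ, ∃ k : K, ∀ x, f^[j] x = F (k, x)) : hpol f = 0 := by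
  subst h
  refine le_antisymm (iSup₂_le fun ε hε => ?_) bot_le
  have h1 : ∀ x : X, ∀ᶠ y in 𝓝 x, ∀ k : K, dist (F (k, y)) (F (k, x)) < ε := by
    intro x
    have := (isCompact_univ (X := K)).eventually_forall_of_forall_eventually
      (x₀ := x) (P := fun y k => dist (F (k, y)) (F (k, x)) < ε) ?_
    · simpa using this
    intro k _
    have hc : Continuous fun z : X × K => dist (F (z.2, z.1)) (F (z.2, x)) := by fun_prop
    exact hc.continuousAt.eventually_lt continuousAt_const (by simpa using hε)
  obtain ⟨T, hT⟩ := isCompact_univ.elim_nhds_subcover _ (fun x _ => h1 x)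
  have h2 : ∀ n, covNum f ε n ≤ T.card := by
    intro n
    refine Nat.sInf_le ⟨T, rfl, fun x => ?_⟩
    have := hT.2 (Set.mem_univ x)
    simp only [Set.mem_iUnion] at this
    obtain ⟨s, hs, hx⟩ := this
    refine ⟨s, hs, fun j _ => ?_⟩
    obtain ⟨k, hk⟩ := hfF j
    rw [hk, hk]
    exact hx k
  have h3 : Tendsto (fun n : ℕ => ENNReal.ofReal (Real.log T.card / Real.log n)) atTop (𝓝 0) := by
    rw [← ENNReal.ofReal_zero]
    exact ENNReal.tendsto_ofReal
      (tendsto_const_nhds.div_atTop (Real.tendsto_log_atTop.comp tendsto_natCast_atTop_atTop))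
  rw [← h3.limsup_eq]
  refine limsup_le_limsup (Eventually.of_forall fun n => ?_)
  apply ENNReal.ofReal_le_ofReal
  apply div_le_div_of_nonneg_right _ (Real.log_natCast_nonneg n)
  rcases Nat.eq_zero_or_pos (covNum f ε n) with h | h
  · rw [h]; simpa using Real.log_natCast_nonneg T.card
  · exact Real.log_le_log (by exact_mod_cast h) (by exact_mod_cast h2 n)

theorem aux_oq (n : ℕ) :
    IsOpenQuotientMap (Projectivization.mk' ℂ : {v : Fin n → ℂ // v ≠ 0} → _) := by
  refine ⟨Quotient.mk''_surjective, continuous_quot_mk, ?_⟩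
  intro U hU
  refine isOpen_coinduced.2 ?_
  have : (Quotient.mk (projectivizationSetoid ℂ (Fin n → ℂ))) ⁻¹' (Projectivization.mk' ℂ '' U) =
      ⋃ t : ℂˣ, (fun v : {v : Fin n → ℂ // v ≠ 0} =>
        (⟨t • v.1, (smul_ne_zero_iff_ne t).2 v.2⟩ : {v : Fin n → ℂ // v ≠ 0})) ⁻¹' U := by
    ext v
    simp only [Set.mem_preimage, Set.mem_iUnion]
    constructor
    · rintro ⟨w, hw, he⟩
      obtain ⟨a, ha⟩ := (Projectivization.mk_eq_mk_iff ℂ w.1 v.1 w.2 v.2).1 he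
      exact ⟨a, by simpa [ha] using hw⟩
    · rintro ⟨a, ha⟩
      exact ⟨_, ha, (Projectivization.mk_eq_mk_iff ℂ _ v.1 _ v.2).2 ⟨a, rfl⟩⟩
  erw [this]
  refine isOpen_iUnion fun t => hU.preimage ?_
  exact Continuous.subtype_mk (continuous_subtype_val.const_smul t) _

theorem aux_compact (n : ℕ) : CompactSpace (Projectivization ℂ (Fin n → ℂ)) := by
  have : CompactSpace (sphere (0 : Fin n → ℂ) 1) := isCompact_iff_compactSpace.1 (isCompact_sphere _ _)
  let φ : sphere (0 : Fin n → ℂ) 1 → Projectivization ℂ (Fin n → ℂ) :=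
    fun v => Projectivization.mk' ℂ ⟨v.1, ne_zero_of_mem_unit_sphere v⟩
  have hφ : Continuous φ := (aux_oq n).continuous.comp (continuous_subtype_val.subtype_mk _)
  have hsurj : Function.Surjective φ := by
    intro p
    induction p using Projectivization.ind with
    | h v hv =>
      have hn : (‖v‖ : ℂ) ≠ 0 := by simpa using hv
      refine ⟨⟨((‖v‖ : ℂ)⁻¹) • v, ?_⟩, ?_⟩
      · simp [norm_smul, hv]
      · exact (Projectivization.mk_eq_mk_iff' ℂ _ v _ hv).2 ⟨_, rfl⟩
  exact hsurj.compactSpace hφ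

theorem aux_inj {n : ℕ} {A : Matrix (Fin n) (Fin n) ℂ} (hA : A.det ≠ 0) :
    Function.Injective (Matrix.toLin' A) := by
  have := Matrix.mulVec_injective_of_isUnit ((Matrix.isUnit_iff_isUnit_det A).2 (Ne.isUnit hA))
  exact this

theorem aux_ne {n : ℕ} {A : Matrix (Fin n) (Fin n) ℂ} (hA : A.det ≠ 0) {v : Fin n → ℂ}
    (hv : v ≠ 0) : A.mulVec v ≠ 0 := by
  intro h
  exact hv (aux_inj hA (by simpa using h))

theorem aux_mk {n : ℕ} {A : Matrix (Fin n) (Fin n) ℂ} (hA : A.det ≠ 0) (v : Fin n → ℂ)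
    (hv : v ≠ 0) : projAction A (Projectivization.mk ℂ v hv) =
      Projectivization.mk ℂ (A.mulVec v) (aux_ne hA hv) := by
  unfold projAction
  rw [dif_pos (aux_inj hA)]
  rfl

theorem aux_iter {n : ℕ} {A : Matrix (Fin n) (Fin n) ℂ} (hA : A.det ≠ 0) (k : ℕ)
    (hk : (A ^ k).det ≠ 0) :
    (projAction A)^[k] = projAction (A ^ k) := by
  funext p
  induction k with
  | zero =>
    induction p using Projectivization.ind with
    | h v hv =>
    rw [aux_mk hk]; simp
  | succ k ih =>
    have hk' : (A ^ k).det ≠ 0 := by rw [Matrix.det_pow]; exact pow_ne_zero _ hA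
    rw [Function.iterate_succ_apply', ih hk']
    induction p using Projectivization.ind with
    | h v hv =>
    rw [aux_mk hk, aux_mk hk', aux_mk hA]
    simp [pow_succ']

theorem aux_cont {n : ℕ} {K : Type*} [TopologicalSpace K]
    (M : K → Matrix (Fin n) (Fin n) ℂ) (hM : Continuous M) (hdet : ∀ k, (M k).det ≠ 0) :
    Continuous fun p : K × Projectivization ℂ (Fin n → ℂ) => projAction (M p.1) p.2 := by
  have hq : IsOpenQuotientMap (Prod.map (id : K → K) (Projectivization.mk' ℂ :
    {v : Fin n → ℂ // v ≠ 0} → _)) := IsOpenQuotientMap.id.prodMap (aux_oq n)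
  rw [← hq.continuous_comp_iff]
  have : ((fun p : K × Projectivization ℂ (Fin n → ℂ) => projAction (M p.1) p.2) ∘
      Prod.map (id : K → K) (Projectivization.mk' ℂ : {v : Fin n → ℂ // v ≠ 0} → _)) =
      (Projectivization.mk' ℂ) ∘ fun q : K × {v : Fin n → ℂ // v ≠ 0} =>
        ⟨(M q.1).mulVec q.2.1, aux_ne (hdet _) q.2.2⟩ := by
    funext q
    simp only [Function.comp, Prod.map, id, Projectivization.mk'_eq_mk]
    exact aux_mk (hdet _) _ _
  rw [this]
  refine (aux_oq n).continuous.comp (Continuous.subtype_mk ?_ _)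
  exact (hM.comp continuous_fst).matrix_mulVec (continuous_subtype_val.comp continuous_snd)

theorem aux_cont1 {n : ℕ} {A : Matrix (Fin n) (Fin n) ℂ} (hA : A.det ≠ 0) :
    Continuous (projAction A) :=
  (aux_cont (K := Unit) (fun _ => A) continuous_const (fun _ => hA)).comp
    (Continuous.prodMk_right ())

theorem aux_surj {n : ℕ} {A : Matrix (Fin n) (Fin n) ℂ} (hA : A.det ≠ 0) :
    Function.Surjective (projAction A) := by
  intro p
  have hu : IsUnit A.det := Ne.isUnit hA
  have hA' : (A⁻¹).det ≠ 0 := (Matrix.isUnit_nonsing_inv_det A hu).ne_zero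
  refine ⟨projAction A⁻¹ p, ?_⟩
  induction p using Projectivization.ind with
  | h v hv =>
  rw [aux_mk hA', aux_mk hA]
  simp [Matrix.mul_nonsing_inv _ hu]

theorem aux_unitary_compact (n : ℕ) : CompactSpace (Matrix.unitaryGroup (Fin n) ℂ) := by
  refine (isCompact_iff_compactSpace (s := (Matrix.unitaryGroup (Fin n) ℂ : Set (Matrix (Fin n) (Fin n) ℂ)))).1 ?_
  have hc : IsClosed (Matrix.unitaryGroup (Fin n) ℂ : Set (Matrix (Fin n) (Fin n) ℂ)) := by
    have : (Matrix.unitaryGroup (Fin n) ℂ : Set (Matrix (Fin n) (Fin n) ℂ)) =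
        {U | U * star U = 1} := by
      ext U; exact Matrix.mem_unitaryGroup_iff
    rw [this]
    exact isClosed_eq (by fun_prop) continuous_const
  have hk : IsCompact (Set.pi Set.univ fun _ : Fin n => Set.pi Set.univ fun _ : Fin n =>
      closedBall (0 : ℂ) 1) :=
    isCompact_univ_pi fun _ => isCompact_univ_pi fun _ => isCompact_closedBall _ _
  refine IsCompact.of_isClosed_subset hk hc ?_
  intro U hU i _ j _
  simpa using entry_norm_bound_of_unitary hU i j

theorem aux_smul {n : ℕ} {A : Matrix (Fin n) (Fin n) ℂ} (hA : A.det ≠ 0) (c : ℂ) (hc : c ≠ 0) :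
    projAction (c • A) = projAction A := by
  have hcA : (c • A).det ≠ 0 := by
    rw [Matrix.det_smul]; exact mul_ne_zero (pow_ne_zero _ hc) hA
  funext p
  induction p using Projectivization.ind with
  | h v hv =>
  rw [aux_mk hA, aux_mk hcA]
  exact (Projectivization.mk_eq_mk_iff' ℂ _ _ _ _).2 ⟨c, by rw [Matrix.smul_mulVec]⟩

theorem aux_back {n : ℕ} (A : Matrix (Fin n) (Fin n) ℂ) (hA : A.det ≠ 0)
    (dm : MetricSpace (Projectivization ℂ (Fin n → ℂ)))
    (hdm : dm.toUniformSpace.toTopologicalSpace =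
      inferInstanceAs (TopologicalSpace (Projectivization ℂ (Fin n → ℂ))))
    (h : IsProjectivelyUnitary A) :
    @hpol _ dm.toPseudoMetricSpace (projAction A) = 0 := by
  obtain ⟨c, hc, C, hC, hU⟩ := h
  have := aux_compact n
  have := aux_unitary_compact n
  have hCu : IsUnit C.det := Ne.isUnit hC
  have hC' : (C⁻¹).det ≠ 0 := (Matrix.isUnit_nonsing_inv_det C hCu).ne_zero
  have hdet : ∀ U : Matrix.unitaryGroup (Fin n) ℂ, (C * U.1 * C⁻¹).det ≠ 0 := by
    intro U
    rw [Matrix.det_mul, Matrix.det_mul]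
    have : U.1.det ≠ 0 := by
      have h2 := congrArg Matrix.det (Matrix.mem_unitaryGroup_iff.1 U.2)
      rw [Matrix.det_mul, Matrix.det_one] at h2
      exact left_ne_zero_of_mul_eq_one h2
    exact mul_ne_zero (mul_ne_zero hC this) hC'
  refine @aux_upper (Projectivization ℂ (Fin n → ℂ)) _ (aux_compact n) dm hdm (projAction A) _ _ _ _
    (aux_cont (K := Matrix.unitaryGroup (Fin n) ℂ) (fun U => C * U.1 * C⁻¹) (by fun_prop) hdet) ?_
  intro j
  set U : Matrix.unitaryGroup (Fin n) ℂ := ⟨_, hU⟩ with hUdef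
  refine ⟨U ^ j, fun x => ?_⟩
  have hAj : (A ^ j).det ≠ 0 := by rw [Matrix.det_pow]; exact pow_ne_zero _ hA
  have e : C * (U ^ j).1 * C⁻¹ = c ^ j • A ^ j := by
    induction j with
    | zero => simp [Matrix.mul_nonsing_inv _ hCu]
    | succ j ih =>
      have hAj : (A ^ j).det ≠ 0 := by rw [Matrix.det_pow]; exact pow_ne_zero _ hA
      have e1 : C * (U ^ (j+1)).1 * C⁻¹ = (C * (U ^ j).1 * C⁻¹) * (C * U.1 * C⁻¹) := by
        simp only [Matrix.mul_assoc]
        rw [← Matrix.mul_assoc C⁻¹ C, Matrix.nonsing_inv_mul _ hCu]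
        simp [pow_succ, Matrix.mul_assoc]
      have e2 : C * U.1 * C⁻¹ = c • A := by
        simp only [hUdef, Matrix.mul_assoc, Matrix.mul_nonsing_inv _ hCu]
        simp only [← Matrix.mul_assoc, Matrix.mul_nonsing_inv _ hCu]
        simp
      rw [e1, ih hAj, e2]
      simp [pow_succ, smul_smul, mul_comm]
  rw [aux_iter hA j hAj]
  simp only [e]
  rw [aux_smul hAj _ (pow_ne_zero _ hc)]

theorem aux_no {n : ℕ} (A : Matrix (Fin n) (Fin n) ℂ) (hA : A.det ≠ 0)
    (dm : MetricSpace (Projectivization ℂ (Fin n → ℂ)))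
    (hdm : dm.toUniformSpace.toTopologicalSpace =
      inferInstanceAs (TopologicalSpace (Projectivization ℂ (Fin n → ℂ))))
    (h : @hpol _ dm.toPseudoMetricSpace (projAction A) = 0)
    (v w : Fin n → ℂ) (hv : v ≠ 0) (hw : w ≠ 0) (u : ℕ → Fin n → ℂ) (c : ℕ → ℂ)
    (hcu : ∀ᶠ k in atTop, c k ≠ 0 ∧ (A ^ k).mulVec v = c k • u k)
    (hu : Tendsto u atTop (𝓝 w)) : ∃ a : ℂ, a • v = w := by
  have := aux_compact n
  by_contra hne
  refine @aux_lower (Projectivization ℂ (Fin n → ℂ)) _ (aux_compact n) dm hdm (projAction A) (aux_cont1 hA) (aux_surj hA)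
    (Projectivization.mk ℂ v hv) (Projectivization.mk ℂ w hw) ?_ ?_ h
  · intro he
    exact hne ((Projectivization.mk_eq_mk_iff' ℂ _ _ _ _).1 he)
  have hdet : ∀ k, (A ^ k).det ≠ 0 := fun k => by
    rw [Matrix.det_pow]; exact pow_ne_zero _ hA
  classical
  let u' : ℕ → {v : Fin n → ℂ // v ≠ 0} := fun k => if h : u k ≠ 0 then ⟨u k, h⟩ else ⟨v, hv⟩
  have hune : ∀ᶠ k in atTop, u k ≠ 0 := hu.eventually_ne hw
  have hu' : Tendsto u' atTop (𝓝 ⟨w, hw⟩) := by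
    rw [tendsto_subtype_rng]
    refine hu.congr' ?_
    filter_upwards [hune] with k hk
    simp only [u', dif_pos hk]
  have h1 := ((aux_oq n).continuous.tendsto ⟨w, hw⟩).comp hu'
  refine h1.congr' ?_
  filter_upwards [hune, hcu] with k hk hck
  simp only [Function.comp, u', dif_pos hk]
  rw [aux_iter hA k (hdet k), aux_mk (hdet k)]
  refine (Projectivization.mk_eq_mk_iff' ℂ _ _ _ _).2 ⟨(c k)⁻¹, ?_⟩
  rw [hck.2, smul_smul, inv_mul_cancel₀ hck.1, one_smul]

theorem aux_pow_eig {n : ℕ} (A : Matrix (Fin n) (Fin n) ℂ) (v : Fin n → ℂ) (l : ℂ)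
    (h : A.mulVec v = l • v) (k : ℕ) : (A ^ k).mulVec v = l ^ k • v := by
  induction k with
  | zero => simp
  | succ k ih =>
    rw [pow_succ, ← Matrix.mulVec_mulVec, h, Matrix.mulVec_smul, ih, smul_smul, pow_succ, mul_comm]

theorem aux_pow_jordan {n : ℕ} (A : Matrix (Fin n) (Fin n) ℂ) (v w : Fin n → ℂ) (l : ℂ)
    (hw : A.mulVec w = l • w) (h : A.mulVec v = l • v + w) (k : ℕ) :
    (A ^ (k + 1)).mulVec v = l ^ (k + 1) • v + ((k + 1 : ℂ) * l ^ k) • w := by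
  induction k with
  | zero => simp [h]
  | succ k ih =>
    rw [pow_succ', ← Matrix.mulVec_mulVec, ih, Matrix.mulVec_add, Matrix.mulVec_smul,
      Matrix.mulVec_smul, h, hw]
    push_cast
    module

theorem aux_eig_ne {n : ℕ} {A : Matrix (Fin n) (Fin n) ℂ} (hA : A.det ≠ 0) {v : Fin n → ℂ}
    (hv : v ≠ 0) {l : ℂ} (h : A.mulVec v = l • v) : l ≠ 0 := by
  rintro rfl
  exact aux_ne hA hv (by simpa using h)

theorem aux_norm_le {n : ℕ} (A : Matrix (Fin n) (Fin n) ℂ) (hA : A.det ≠ 0)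
    (dm : MetricSpace (Projectivization ℂ (Fin n → ℂ)))
    (hdm : dm.toUniformSpace.toTopologicalSpace =
      inferInstanceAs (TopologicalSpace (Projectivization ℂ (Fin n → ℂ))))
    (h : @hpol _ dm.toPseudoMetricSpace (projAction A) = 0)
    (v w : Fin n → ℂ) (hv : v ≠ 0) (hw : w ≠ 0) (l m : ℂ)
    (hl : A.mulVec v = l • v) (hm : A.mulVec w = m • w) : ‖l‖ ≤ ‖m‖ := by
  by_contra! hlt
  have hl0 := aux_eig_ne hA hv hl
  have hlm : l ≠ m := by rintro rfl; exact lt_irrefl _ hlt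
  have hind : ∀ a : ℂ, a • (v + w) ≠ v := by
    intro a ha
    have h1 : (1 - a) • v = a • w := by linear_combination (norm := module) -ha
    have h2 : ((1 - a) * (l - m)) • v = 0 := by
      have := congrArg A.mulVec h1
      rw [Matrix.mulVec_smul, Matrix.mulVec_smul, hl, hm] at this
      linear_combination (norm := module) this - m • h1
    have h3 : 1 - a = 0 := by
      rcases smul_eq_zero.1 h2 with h | h
      · exact (mul_eq_zero.1 h).resolve_right (sub_ne_zero.2 hlm)
      · exact (hv h).elim
    rw [h3, zero_smul] at h1
    rcases smul_eq_zero.1 h1.symm with h | h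
    · rw [h] at h3; simp at h3
    · exact hw h
  have hvw : v + w ≠ 0 := by
    intro h0
    have h1 : w = -v := by linear_combination (norm := module) h0
    rw [h1, Matrix.mulVec_neg, hl] at hm
    have : (m - l) • v = 0 := by linear_combination (norm := module) hm
    rcases smul_eq_zero.1 this with h | h
    · exact hlm (sub_eq_zero.1 h).symm
    · exact hv h
  suffices hex : ∃ a : ℂ, a • (v + w) = v by
    obtain ⟨a, ha⟩ := hex
    exact hind a ha
  refine aux_no A hA dm hdm h (v + w) v hvw hv (fun k => v + (m / l) ^ k • w)
    (fun k => l ^ k) (Eventually.of_forall fun k => ⟨pow_ne_zero _ hl0, ?_⟩) ?_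
  · rw [Matrix.mulVec_add, aux_pow_eig A v l hl, aux_pow_eig A w m hm, smul_add, smul_smul,
      ← mul_pow, mul_div_cancel₀ _ hl0]
  · have h1 : Tendsto (fun k : ℕ => (m / l) ^ k) atTop (𝓝 0) := by
      apply tendsto_pow_atTop_nhds_zero_of_norm_lt_one
      rw [norm_div, div_lt_one (norm_pos_iff.2 hl0)]
      exact hlt
    simpa using tendsto_const_nhds.add (h1.smul_const w)

theorem aux_semis {n : ℕ} (A : Matrix (Fin n) (Fin n) ℂ) (hA : A.det ≠ 0)
    (dm : MetricSpace (Projectivization ℂ (Fin n → ℂ)))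
    (hdm : dm.toUniformSpace.toTopologicalSpace =
      inferInstanceAs (TopologicalSpace (Projectivization ℂ (Fin n → ℂ))))
    (h : @hpol _ dm.toPseudoMetricSpace (projAction A) = 0)
    (v w : Fin n → ℂ) (l : ℂ)
    (hl : A.mulVec v = l • v + w) (hm : A.mulVec w = l • w) : w = 0 := by
  by_contra hw
  have hl0 := aux_eig_ne hA hw hm
  have hv : v ≠ 0 := by
    rintro rfl
    apply hw
    simpa using hl.symm
  suffices hex : ∃ a : ℂ, a • v = w by
    obtain ⟨a, ha⟩ := hex
    rw [← ha, Matrix.mulVec_smul, hl] at hm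
    have h1 : a • w = 0 := by linear_combination (norm := module) hm
    rcases smul_eq_zero.1 h1 with h | h
    · rw [h, zero_smul] at ha; exact hw ha.symm
    · exact hw h
  refine aux_no A hA dm hdm h v w hv hw (fun k => (l / k) • v + w)
    (fun k => (k : ℂ) * l ^ (k - 1)) ?_ ?_
  · filter_upwards [eventually_ge_atTop 1] with k hk
    obtain ⟨k, rfl⟩ := Nat.exists_eq_add_of_le' hk
    have hk0 : ((k + 1 : ℕ) : ℂ) ≠ 0 := Nat.cast_ne_zero.2 (by omega)
    refine ⟨mul_ne_zero hk0 (pow_ne_zero _ hl0), ?_⟩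
    rw [aux_pow_jordan A v w l hm hl, smul_add, smul_smul, Nat.add_sub_cancel]
    congr 2
    · field_simp
      ring
    · push_cast; rfl
  · have h1 : Tendsto (fun k : ℕ => l / (k : ℂ)) atTop (𝓝 0) :=
      tendsto_const_div_atTop_nhds_zero_nat l
    simpa using (h1.smul_const v).add_const w

theorem aux_forw {n : ℕ} (A : Matrix (Fin n) (Fin n) ℂ) (hA : A.det ≠ 0) (hn : 0 < n)
    (dm : MetricSpace (Projectivization ℂ (Fin n → ℂ)))
    (hdm : dm.toUniformSpace.toTopologicalSpace =
      inferInstanceAs (TopologicalSpace (Projectivization ℂ (Fin n → ℂ))))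
    (h : @hpol _ dm.toPseudoMetricSpace (projAction A) = 0) : IsProjectivelyUnitary A := by
  set f := Matrix.toLin' A with hf
  have hpow : ∀ (μ : ℂ) (k : ℕ) (v : Fin n → ℂ),
      ((f - algebraMap ℂ _ μ) ^ (k + 1)) v = 0 → (f - algebraMap ℂ _ μ) v = 0 := by
    intro μ k
    induction k with
    | zero => intro v hv; simpa using hv
    | succ k ih =>
      intro v hv
      rw [pow_succ, Module.End.mul_apply] at hv
      have h1 := ih _ hv
      refine aux_semis A hA dm hdm h v _ μ ?_ ?_
      · simp [hf, Module.algebraMap_end_apply]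
      · rw [LinearMap.sub_apply, sub_eq_zero, Module.algebraMap_end_apply] at h1
        exact h1
  have hspan : ⊤ ≤ Submodule.span ℂ {v : Fin n → ℂ | ∃ μ : ℂ, A.mulVec v = μ • v} := by
    rw [← Module.End.iSup_maxGenEigenspace_eq_top f]
    refine iSup_le fun μ v hv => ?_
    rw [Module.End.mem_maxGenEigenspace] at hv
    obtain ⟨k, hk⟩ := hv
    apply Submodule.subset_span
    refine ⟨μ, ?_⟩
    have h1 := hpow μ k v (by
      rw [pow_succ', Module.End.mul_apply]
      have : (f - algebraMap ℂ _ μ) = f - μ • 1 := by rw [Algebra.algebraMap_eq_smul_one]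
      rw [this, hk, map_zero])
    rw [LinearMap.sub_apply, sub_eq_zero, Module.algebraMap_end_apply] at h1
    exact h1
  let b0 := Module.Basis.ofSpan hspan
  have := FiniteDimensional.fintypeBasisIndex b0
  let b : Module.Basis (Fin n) ℂ (Fin n → ℂ) := b0.reindex
    (Fintype.equivOfCardEq (by rw [← Module.finrank_eq_card_basis b0]; simp))
  have hb : ∀ i, ∃ μ : ℂ, A.mulVec (b i) = μ • b i := by
    intro i
    have : b i ∈ Set.range b0 := by simp [b]
    exact Module.Basis.ofSpan_subset hspan this
  choose d hd using hb
  have hbn : ∀ i, b i ≠ 0 := fun i => b.ne_zero i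
  have hd0 : ∀ i, d i ≠ 0 := fun i => aux_eig_ne hA (hbn i) (hd i)
  let r : ℝ := ‖d ⟨0, hn⟩‖
  have hr : ∀ i, ‖d i‖ = r := fun i => le_antisymm
    (aux_norm_le A hA dm hdm h _ _ (hbn _) (hbn _) _ _ (hd i) (hd _))
    (aux_norm_le A hA dm hdm h _ _ (hbn _) (hbn _) _ _ (hd _) (hd i))
  have hr0 : r ≠ 0 := norm_ne_zero_iff.2 (hd0 _)
  let C : Matrix (Fin n) (Fin n) ℂ := (Pi.basisFun ℂ (Fin n)).toMatrix b
  have hC : IsUnit C.det := by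
    have h1 := Module.Basis.toMatrix_mul_toMatrix_flip (Pi.basisFun ℂ (Fin n)) b
    exact Matrix.isUnit_det_of_right_inverse h1
  have hAC : A * C = C * Matrix.diagonal d := by
    ext i j
    rw [Matrix.mul_diagonal]
    have := congrFun (hd j) i
    simpa [C, Matrix.mul_apply, Matrix.mulVec, dotProduct, Module.Basis.toMatrix_apply, mul_comm]
      using this
  refine ⟨(r : ℂ)⁻¹, by simpa using hr0, C, hC.ne_zero, ?_⟩
  have e : C⁻¹ * ((r : ℂ)⁻¹ • A) * C = Matrix.diagonal fun i => (r : ℂ)⁻¹ * d i := by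
    rw [Matrix.mul_assoc, Matrix.smul_mul, hAC, Matrix.mul_smul, ← Matrix.mul_assoc,
      Matrix.nonsing_inv_mul _ hC, Matrix.one_mul, ← Matrix.diagonal_smul]
    rfl
  rw [e, Matrix.mem_unitaryGroup_iff, Matrix.star_eq_conjTranspose,
    Matrix.diagonal_conjTranspose, Matrix.diagonal_mul_diagonal, ← Matrix.diagonal_one]
  congr 1
  funext i
  have h1 : ‖(r : ℂ)⁻¹ * d i‖ = 1 := by
    rw [norm_mul, hr, norm_inv, Complex.norm_real, Real.norm_of_nonneg (norm_nonneg _)]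
    exact inv_mul_cancel₀ hr0
  have h2 := Complex.mul_conj' ((r : ℂ)⁻¹ * d i)
  rw [h1] at h2
  simpa using h2

/-- Let `g ∈ PGL₃(ℂ)` (represented by an invertible matrix `A`) act on `ℙ²(ℂ)`, and let
`d` be any metric on `ℙ²(ℂ)` inducing its topology.  Then `hpol g = 0` iff `g` is
represented by a matrix conjugate to a unitary matrix (equivalently, `g` is conjugate in
`PGL₃(ℂ)` to an element of `PU₃(ℂ)`, i.e. `g` is an isometry for some Fubini–Study
metric). -/
theorem hpol_PGL3_eq_zero_iff (A : Matrix (Fin 3) (Fin 3) ℂ) (hA : A.det ≠ 0)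
    (dm : MetricSpace (Projectivization ℂ (Fin 3 → ℂ)))
    (hdm : dm.toUniformSpace.toTopologicalSpace =
      inferInstanceAs (TopologicalSpace (Projectivization ℂ (Fin 3 → ℂ)))) :
    @hpol _ dm.toPseudoMetricSpace (projAction A) = 0 ↔ IsProjectivelyUnitary A := by
  exact ⟨aux_forw A hA (by norm_num) dm hdm, aux_back A hA dm hdm⟩
end

section
/- Let 𝔻̄ denote the closed unit disk in ℂ and let b be a holomorphic function on an open neighborhood of 𝔻̄ that does not vanish on 𝔻̄. Let g be the homeomorphism of the compact space 𝔻̄ × ℙ¹(ℂ) defined by g(x, [y₀:y₁]) = (x, [y₀ + b(x)·y₁ : y₁]). Then, for any metric on 𝔻̄ × ℙ¹(ℂ) inducing the product topology, hpol(g) = 1. -/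
open Filter Topology Metric
open scoped ENNReal

variable {X : Type*}

def BowenCover {X : Type*} [PseudoMetricSpace X] (f : X → X) (ε : ℝ) (n : ℕ) (S : Finset X) : Prop :=
  ∀ x : X, ∃ s ∈ S, ∀ j < n, dist (f^[j] x) (f^[j] s) < ε

lemma cover_of_code {X T : Type*} [PseudoMetricSpace X] [Fintype T] (f : X → X) (ε : ℝ) (n : ℕ)
    (c : X → T) (hc : ∀ p q, c p = c q → ∀ j < n, dist (f^[j] p) (f^[j] q) < ε) :
    ∃ S : Finset X, BowenCover f ε n S ∧ S.card ≤ Fintype.card T := by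
  classical
  have hfin : (Set.range c).Finite := Set.toFinite _
  rcases isEmpty_or_nonempty X with hE | hE
  · exact ⟨∅, fun x => hE.elim x, by simp⟩
  choose! r hr using fun (t : T) (ht : t ∈ Set.range c) => ht
  refine ⟨hfin.toFinset.image r, ?_, ?_⟩
  · intro x
    refine ⟨r (c x), Finset.mem_image_of_mem _ (by simp), ?_⟩
    exact hc _ _ (hr (c x) ⟨x, rfl⟩).symm
  · exact Finset.card_image_le.trans (Finset.card_le_univ _)

lemma upper_cover {X D : Type*} [MetricSpace X] [CompactSpace X] [MetricSpace D] [CompactSpace D]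
    (g : X → X) (hg : Continuous g) (π : X → D) (hπ : Continuous π) (s : D → X) (hs : Continuous s)
    (hπg : ∀ p, π (g p) = π p) (h : X → ℝ) (hh : Continuous h) (h0 : ∀ p, 0 ≤ h p)
    (hz : ∀ p, h p = 0 → p = s (π p))
    (ha : ∀ c : ℝ, 0 < c → ∃ L : ℕ, ∀ p i, L < i → c ≤ h p → h (g^[i] p) < c)
    (ε : ℝ) (hε : 0 < ε) :
    ∃ m : ℕ, ∀ n : ℕ, ∃ S : Finset X, BowenCover g ε n S ∧ S.card ≤ (n + 1) * m := by
  classical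
  set K : Set X := {p | ε / 3 ≤ dist p (s (π p))} with hK
  have hKc : IsCompact K :=
    (isClosed_le continuous_const (continuous_id.dist (hs.comp hπ))).isCompact
  have hpos : ∀ p ∈ K, 0 < h p := by
    intro p hp
    rcases (h0 p).lt_or_eq with h1 | h1
    · exact h1
    · exfalso
      have h2 := hz p h1.symm
      have h3 : dist p (s (π p)) = 0 := by rw [dist_eq_zero]; exact h2
      have : ε / 3 ≤ dist p (s (π p)) := hp
      linarith
  obtain ⟨c, hc, hcK⟩ : ∃ c : ℝ, 0 < c ∧ ∀ p ∈ K, c ≤ h p := by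
    rcases K.eq_empty_or_nonempty with he | hne
    · exact ⟨1, one_pos, by simp [he]⟩
    · obtain ⟨p, hp, hmin⟩ := hKc.exists_isMinOn hne hh.continuousOn
      exact ⟨h p, hpos p hp, fun q hq => hmin hq⟩
  obtain ⟨L, hL⟩ := ha c hc
  have hLK : ∀ p ∈ K, ∀ i, L < i → g^[i] p ∉ K := fun p hp i hi hmem =>
    absurd (hcK _ hmem) (not_le.2 (hL p i hi (hcK p hp)))
  -- uniform continuity
  have hu1 : UniformContinuous (fun p => s (π p)) :=
    CompactSpace.uniformContinuous_of_continuous (hs.comp hπ)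
  obtain ⟨δ₁, hδ₁, h1⟩ := Metric.uniformContinuous_iff.1 hu1 (ε / 3) (by positivity)
  have hu2 : ∀ i : ℕ, ∃ δ > 0, ∀ p q : X, dist p q < δ → dist (g^[i] p) (g^[i] q) < ε := by
    intro i
    have := CompactSpace.uniformContinuous_of_continuous (hg.iterate i)
    obtain ⟨δ, hδ, h⟩ := Metric.uniformContinuous_iff.1 this ε hε
    exact ⟨δ, hδ, fun p q => @h p q⟩
  choose δf hδf h2 using hu2
  obtain ⟨δ, hδ, hδ1, hδ2⟩ : ∃ δ > 0, δ ≤ δ₁ ∧ ∀ i ≤ L, δ ≤ δf i := by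
    have : ∀ M : ℕ, ∃ δ > 0, δ ≤ δ₁ ∧ ∀ i < M, δ ≤ δf i := by
      intro M
      induction M with
      | zero => exact ⟨δ₁, hδ₁, le_rfl, by simp⟩
      | succ M ih =>
        obtain ⟨δ, a, b, c⟩ := ih
        refine ⟨min δ (δf M), lt_min a (hδf M), (min_le_left _ _).trans b, ?_⟩
        intro i hi
        rcases Nat.lt_succ_iff_lt_or_eq.1 hi with h | rfl
        · exact (min_le_left _ _).trans (c i h)
        · exact min_le_right _ _
    obtain ⟨δ, a, b, c⟩ := this (L + 1)
    exact ⟨δ, a, b, fun i hi => c i (by omega)⟩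
  obtain ⟨t, -, htf, htc⟩ := finite_cover_balls_of_compact (isCompact_univ (X := X)) (half_pos hδ)
  have hcell : ∀ p : X, ∃ y : t, dist p y < δ / 2 := by
    intro p
    have := htc (Set.mem_univ p)
    simp only [Set.mem_iUnion, Metric.mem_ball] at this
    obtain ⟨y, hy, hd⟩ := this
    exact ⟨⟨y, hy⟩, hd⟩
  choose cell hcell using hcell
  have hcc : ∀ p q, cell p = cell q → dist p q < δ := by
    intro p q hpq
    have a := hcell p
    have b := hcell q
    rw [← hpq] at b
    have := dist_triangle_right p q (cell p : X)
    linarith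
  haveI : Fintype t := htf.fintype
  have hπi : ∀ i p, π (g^[i] p) = π p := by
    intro i
    induction i with
    | zero => simp
    | succ i ih => intro p; rw [Function.iterate_succ_apply', hπg, ih]
  refine ⟨Fintype.card t, fun n => ?_⟩
  -- first entry time
  have hk : ∀ p : X, ∃ k : Fin (n + 1), (∀ j < (k : ℕ), g^[j] p ∉ K) ∧
      ((k : ℕ) < n → g^[k] p ∈ K) := by
    intro p
    have hex : ∃ k, k = n ∨ g^[k] p ∈ K := ⟨n, Or.inl rfl⟩
    have hle : Nat.find hex ≤ n := Nat.find_min' hex (Or.inl rfl)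
    refine ⟨⟨Nat.find hex, by omega⟩, ?_, ?_⟩
    · intro j hj hmem
      exact Nat.find_min hex hj (Or.inr hmem)
    · intro hlt
      rcases Nat.find_spec hex with h | h
      · simp only at hlt; omega
      · exact h
  choose k hk1 hk2 using hk
  have := cover_of_code g ε n (T := Fin (n + 1) × t) (fun p => (k p, cell (g^[k p] p))) ?_
  · simpa using this
  intro p q hpq j hj
  simp only [Prod.mk.injEq] at hpq
  obtain ⟨hkk, hce⟩ := hpq
  have hd := hcc _ _ hce
  have hout : g^[j] p ∉ K → g^[j] q ∉ K → dist (g^[j] p) (g^[j] q) < ε := by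
    intro hp hq
    have e1 : dist (g^[j] p) (s (π (g^[j] p))) < ε / 3 := not_le.1 hp
    have e2 : dist (g^[j] q) (s (π (g^[j] q))) < ε / 3 := not_le.1 hq
    have e3 := h1 (lt_of_lt_of_le hd hδ1)
    simp only [hπi] at e1 e2 e3
    have e4 := dist_triangle4_right (g^[j] p) (g^[j] q) (s (π p)) (s (π q))
    linarith
  by_cases hjk : j < k p
  · exact hout (hk1 p j hjk) (hk1 q j (hkk ▸ hjk))
  · push Not at hjk
    obtain ⟨i, rfl⟩ := Nat.exists_eq_add_of_le' hjk
    have e : g^[i + k p] q = g^[i] (g^[k q] q) := by rw [Function.iterate_add_apply, hkk]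
    by_cases hi : i ≤ L
    · rw [e, Function.iterate_add_apply]
      exact h2 i _ _ (lt_of_lt_of_le hd (hδ2 i hi))
    · push Not at hi
      apply hout
      · rw [Function.iterate_add_apply]
        exact hLK _ (hk2 p (by omega)) i hi
      · rw [e]
        exact hLK _ (hk2 q (by rw [← hkk]; omega)) i hi

lemma lower_cover {X : Type*} [MetricSpace X] [CompactSpace X] (g : X → X) (h : X → ℝ)
    (hh : Continuous h) (p : ℕ → X) (r : ℝ) (hr : r < 1) (hp : ∀ k, h (g^[k] (p k)) = 1)
    (hp' : ∀ k l, k ≠ l → h (g^[k] (p l)) ≤ r) :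
    ∃ ε > 0, ∀ n (S : Finset X), BowenCover g ε n S → n ≤ S.card := by
  have hu := CompactSpace.uniformContinuous_of_continuous hh
  obtain ⟨δ, hδ, h1⟩ := Metric.uniformContinuous_iff.1 hu (1 - r) (by linarith)
  refine ⟨δ / 2, by positivity, fun n S hS => ?_⟩
  choose c hcS hc using hS
  have := Finset.card_le_card_of_injOn (s := Finset.range n) (t := S) (fun k => c (p k))
    (fun k _ => hcS _) ?_
  · simpa using this
  intro k hk l hl hkl
  by_contra hne
  simp only [Finset.coe_range, Set.mem_Iio] at hk hl hkl
  have a := hc (p k) k hk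
  have b := hc (p l) k hk
  rw [← hkl] at b
  have d := dist_triangle_right (g^[k] (p k)) (g^[k] (p l)) (g^[k] (c (p k)))
  have e := h1 (show dist (g^[k] (p k)) (g^[k] (p l)) < δ by linarith)
  rw [hp, Real.dist_eq] at e
  have := hp' k l hne
  have := (abs_lt.1 e).2
  linarith

lemma hpol_eq_one {X : Type*} [MetricSpace X] (g : X → X)
    (hup : ∀ ε > 0, ∃ m : ℕ, ∀ n : ℕ, ∃ S : Finset X, BowenCover g ε n S ∧ S.card ≤ (n + 1) * m)
    (hlo : ∃ ε > 0, ∀ n (S : Finset X), BowenCover g ε n S → n ≤ S.card) :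
    hpol g = 1 := by
  have hlog : Tendsto (fun n : ℕ => Real.log n) atTop atTop :=
    Real.tendsto_log_atTop.comp tendsto_natCast_atTop_atTop
  apply le_antisymm
  · refine iSup₂_le fun ε hε => ?_
    obtain ⟨m, hm⟩ := hup ε hε
    have hb : ∀ n, covNum g ε n ≤ (n + 1) * m := by
      intro n
      obtain ⟨S, hS, hc⟩ := hm n
      have : covNum g ε n ≤ S.card := Nat.sInf_le ⟨S, rfl, hS⟩
      exact this.trans hc
    have hlim : Tendsto (fun n : ℕ => ENNReal.ofReal (Real.log (2 * (m + 1)) / Real.log n + 1))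
        atTop (𝓝 1) := by
      have h1 : Tendsto (fun n : ℕ => Real.log (2 * (m + 1)) / Real.log n + 1) atTop (𝓝 (0 + 1)) :=
        (hlog.const_div_atTop _).add_const 1
      simpa [Function.comp_def] using (ENNReal.continuous_ofReal.tendsto _).comp h1
    rw [← hlim.limsup_eq]
    apply Filter.limsup_le_limsup
    · filter_upwards [eventually_ge_atTop 2] with n hn
      apply ENNReal.ofReal_le_ofReal
      have hn' : (2 : ℝ) ≤ n := by exact_mod_cast hn
      have hl : 0 < Real.log n := Real.log_pos (by linarith)
      rw [div_add_one hl.ne']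
      apply div_le_div_of_nonneg_right _ hl.le
      have hm0 : (0 : ℝ) ≤ m := Nat.cast_nonneg m
      have hl2 : 0 ≤ Real.log (2 * (m + 1)) := Real.log_nonneg (by linarith)
      rcases Nat.eq_zero_or_pos (covNum g ε n) with h0 | h0
      · rw [h0]; simp only [Nat.cast_zero, Real.log_zero]; linarith
      · rw [← Real.log_mul (by positivity) (by positivity)]
        apply Real.log_le_log (by exact_mod_cast h0)
        have : (covNum g ε n : ℝ) ≤ (n + 1) * m := by exact_mod_cast hb n
        nlinarith [mul_nonneg hm0 (by linarith : (0:ℝ) ≤ n)]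
    all_goals isBoundedDefault
  · obtain ⟨ε, hε, hlo⟩ := hlo
    obtain ⟨m, hm⟩ := hup ε hε
    have hb : ∀ n, n ≤ covNum g ε n := by
      intro n
      obtain ⟨S, hS, -⟩ := hm n
      obtain ⟨S', hc, hS'⟩ := Nat.sInf_mem (s := {m : ℕ | ∃ S : Finset X, S.card = m ∧
        ∀ x : X, ∃ s ∈ S, ∀ j < n, dist (g^[j] x) (g^[j] s) < ε}) ⟨_, S, rfl, hS⟩
      exact (hlo n S' hS').trans hc.le
    refine le_trans ?_ (le_iSup₂ (f := fun (ε : ℝ) (_ : 0 < ε) =>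
      Filter.atTop.limsup fun n : ℕ => ENNReal.ofReal (Real.log (covNum g ε n) / Real.log n)) ε hε)
    rw [← (tendsto_const_nhds (x := (1 : ℝ≥0∞)) (f := (atTop : Filter ℕ))).limsup_eq]
    apply Filter.limsup_le_limsup
    · filter_upwards [eventually_ge_atTop 2] with n hn
      have hn' : (2 : ℝ) ≤ n := by exact_mod_cast hn
      have hl : 0 < Real.log n := Real.log_pos (by linarith)
      rw [← ENNReal.ofReal_one]
      apply ENNReal.ofReal_le_ofReal
      rw [one_le_div hl]
      exact Real.log_le_log (by linarith) (by exact_mod_cast hb n)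
    all_goals isBoundedDefault

lemma hpol_combined {X D : Type*} [t : TopologicalSpace X] [CompactSpace X] [MetricSpace D]
    [CompactSpace D] (dm : MetricSpace X) (hdm : dm.toUniformSpace.toTopologicalSpace = t)
    (g : X → X) (hg : T2Space X → Continuous g) (π : X → D) (hπ : Continuous π) (s : D → X)
    (hs : Continuous s)
    (hπg : ∀ p, π (g p) = π p) (h : X → ℝ) (hh : Continuous h) (h0 : ∀ p, 0 ≤ h p)
    (hz : ∀ p, h p = 0 → p = s (π p))
    (ha : ∀ c : ℝ, 0 < c → ∃ L : ℕ, ∀ p i, L < i → c ≤ h p → h (g^[i] p) < c)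
    (p : ℕ → X) (r : ℝ) (hr : r < 1) (hp : ∀ k, h (g^[k] (p k)) = 1)
    (hp' : ∀ k l, k ≠ l → h (g^[k] (p l)) ≤ r) :
    @hpol _ dm.toPseudoMetricSpace g = 1 := by
  subst hdm
  exact hpol_eq_one g (fun ε hε => upper_cover g (hg inferInstance) π hπ s hs hπg h hh h0 hz ha ε hε)
    (lower_cover g h hh p r hr hp hp')

abbrev PP := Projectivization ℂ (Fin 2 → ℂ)

lemma mk_continuous : Continuous (fun v : {v : Fin 2 → ℂ // v ≠ 0} =>
    (Projectivization.mk ℂ v.1 v.2 : PP)) := continuous_quotient_mk'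

lemma sphere_ne (v : Metric.sphere (0 : Fin 2 → ℂ) 1) : (v : Fin 2 → ℂ) ≠ 0 := by
  intro h
  have := v.2
  rw [h] at this
  simp at this

noncomputable def sphMk (v : Metric.sphere (0 : Fin 2 → ℂ) 1) : PP := Projectivization.mk ℂ v.1 (sphere_ne v)

lemma sphMk_continuous : Continuous sphMk :=
  mk_continuous.comp (Continuous.subtype_mk continuous_subtype_val sphere_ne)

lemma sphMk_surjective : Function.Surjective sphMk := by
  intro y
  induction y using Projectivization.ind with
  | h v hv =>
    have hn : ‖v‖ ≠ 0 := norm_ne_zero_iff.2 hv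
    refine ⟨⟨((‖v‖ : ℂ)⁻¹) • v, ?_⟩, ?_⟩
    · simp [norm_smul, hn]
    · unfold sphMk
      rw [Projectivization.mk_eq_mk_iff']
      exact ⟨(‖v‖ : ℂ)⁻¹, rfl⟩

instance : CompactSpace PP := by
  refine ⟨?_⟩
  rw [← sphMk_surjective.range_eq]
  exact isCompact_range sphMk_continuous

lemma den_pos {v : Fin 2 → ℂ} (hv : v ≠ 0) : 0 < ‖v 0‖ + ‖v 1‖ := by
  rcases (add_nonneg (norm_nonneg (v 0)) (norm_nonneg (v 1))).lt_or_eq with h | h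
  · exact h
  · exfalso
    apply hv
    have h0 : ‖v 0‖ = 0 := by linarith [norm_nonneg (v 0), norm_nonneg (v 1)]
    have h1 : ‖v 1‖ = 0 := by linarith [norm_nonneg (v 0), norm_nonneg (v 1)]
    ext i
    fin_cases i
    · simpa using h0
    · simpa using h1

noncomputable def hh : PP → ℝ := Projectivization.lift (fun v => ‖v.1 1‖ / (‖v.1 0‖ + ‖v.1 1‖)) (by
  rintro ⟨a, ha⟩ ⟨b, hb⟩ t h
  simp only at h
  subst h
  have ht : t ≠ 0 := by rintro rfl; simp at ha
  have : ‖t‖ ≠ 0 := norm_ne_zero_iff.2 ht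
  simp only [Pi.smul_apply, smul_eq_mul, norm_mul]
  rw [← mul_add, mul_div_mul_left _ _ this])

lemma hh_mk (v : Fin 2 → ℂ) (hv : v ≠ 0) :
    hh (Projectivization.mk ℂ v hv) = ‖v 1‖ / (‖v 0‖ + ‖v 1‖) := rfl

lemma hh_continuous : Continuous hh := by
  apply Continuous.quotient_lift
  have c (i : Fin 2) : Continuous (fun v : {v : Fin 2 → ℂ // v ≠ 0} => ‖v.1 i‖) :=
    ((continuous_apply i).comp continuous_subtype_val).norm
  apply Continuous.div
  · exact c 1
  · exact (c 0).add (c 1)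
  · intro v
    exact (den_pos v.2).ne'

noncomputable def sh (c : ℂ) (v : Fin 2 → ℂ) : Fin 2 → ℂ := ![v 0 + c * v 1, v 1]

lemma sh_ne (c : ℂ) {v : Fin 2 → ℂ} (hv : v ≠ 0) : sh c v ≠ 0 := by
  intro h
  apply hv
  have h0 := congrFun h 0
  have h1 := congrFun h 1
  simp [sh] at h0 h1
  rw [h1] at h0
  ext i
  fin_cases i
  · simpa using h0
  · simpa using h1

lemma mulVec_sh (c : ℂ) (v : Fin 2 → ℂ) : Matrix.toLin' !![1, c; 0, 1] v = sh c v := by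
  ext i
  fin_cases i <;> simp [sh, Matrix.mulVec, dotProduct, Fin.sum_univ_two]

lemma projAction_mk (c : ℂ) (v : Fin 2 → ℂ) (hv : v ≠ 0) :
    projAction !![1, c; 0, 1] (Projectivization.mk ℂ v hv)
      = Projectivization.mk ℂ (sh c v) (sh_ne c hv) := by
  have hinj : Function.Injective (Matrix.toLin' !![1, c; 0, 1]) := by
    rw [injective_iff_map_eq_zero]
    intro a ha
    rw [mulVec_sh] at ha
    by_contra hne
    exact sh_ne c hne ha
  unfold projAction
  rw [dif_pos hinj, Projectivization.map_mk]
  congr 1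
  exact mulVec_sh c v

lemma sh_sh (c d : ℂ) (v : Fin 2 → ℂ) : sh c (sh d v) = sh (d + c) v := by
  ext i
  fin_cases i
  · simp [sh]; ring
  · simp [sh]

lemma sh_zero (v : Fin 2 → ℂ) : sh 0 v = v := by
  ext i
  fin_cases i <;> simp [sh]

lemma mk_congr {v w : Fin 2 → ℂ} (h : v = w) (hv : v ≠ 0) (hw : w ≠ 0) :
    Projectivization.mk ℂ v hv = Projectivization.mk ℂ w hw := by
  subst h; rfl

lemma iter_mk (b : ℂ → ℂ) (x : Metric.closedBall (0 : ℂ) 1) (v : Fin 2 → ℂ) (hv : v ≠ 0) (i : ℕ) :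
    (fun p : (Metric.closedBall (0 : ℂ) 1) × PP =>
        (p.1, projAction !![1, b (p.1 : ℂ); 0, 1] p.2))^[i] (x, Projectivization.mk ℂ v hv)
      = (x, Projectivization.mk ℂ (sh (i * b x) v) (sh_ne _ hv)) := by
  induction i with
  | zero => simp [sh_zero]
  | succ i ih =>
    rw [Function.iterate_succ_apply', ih]
    simp only [projAction_mk]
    refine Prod.ext rfl (mk_congr ?_ _ _)
    rw [sh_sh]
    push_cast
    congr 1
    ring

lemma g_continuous (b : ℂ → ℂ) (hb : ContinuousOn b (Metric.closedBall (0 : ℂ) 1))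
    (hT : T2Space ((Metric.closedBall (0 : ℂ) 1) × PP)) :
    Continuous (fun p : (Metric.closedBall (0 : ℂ) 1) × PP =>
        (p.1, projAction !![1, b (p.1 : ℂ); 0, 1] p.2)) := by
  have hq : Continuous (Prod.map id sphMk :
      (Metric.closedBall (0 : ℂ) 1) × (Metric.sphere (0 : Fin 2 → ℂ) 1) → _) :=
    continuous_id.prodMap sphMk_continuous
  have hs : Function.Surjective (Prod.map id sphMk :
      (Metric.closedBall (0 : ℂ) 1) × (Metric.sphere (0 : Fin 2 → ℂ) 1) → _) :=
    Function.surjective_id.prodMap sphMk_surjective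
  have hQ := hq.isClosedMap.isQuotientMap hq hs
  rw [hQ.continuous_iff]
  have hb' : Continuous (fun x : Metric.closedBall (0 : ℂ) 1 => b x) := hb.restrict
  have : ((fun p : (Metric.closedBall (0 : ℂ) 1) × PP =>
        (p.1, projAction !![1, b (p.1 : ℂ); 0, 1] p.2)) ∘ Prod.map id sphMk) =
      fun p : (Metric.closedBall (0 : ℂ) 1) × (Metric.sphere (0 : Fin 2 → ℂ) 1) =>
        (p.1, Projectivization.mk ℂ (sh (b p.1) p.2) (sh_ne _ (sphere_ne p.2))) := by
    funext p
    simp only [Function.comp, Prod.map, sphMk, projAction_mk, id]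
  rw [this]
  have h1 : Continuous fun p : (Metric.closedBall (0 : ℂ) 1) × (Metric.sphere (0 : Fin 2 → ℂ) 1) =>
    b p.1 := hb'.comp continuous_fst
  have h2 (i : Fin 2) : Continuous fun p : (Metric.closedBall (0 : ℂ) 1) ×
      (Metric.sphere (0 : Fin 2 → ℂ) 1) => (p.2 : Fin 2 → ℂ) i :=
    (continuous_apply i).comp (continuous_subtype_val.comp continuous_snd)
  have h3 : Continuous fun p : (Metric.closedBall (0 : ℂ) 1) ×
      (Metric.sphere (0 : Fin 2 → ℂ) 1) => sh (b p.1) p.2 := by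
    refine continuous_pi fun i => ?_
    fin_cases i
    · exact (h2 0).add (h1.mul (h2 1))
    · exact h2 1
  exact continuous_fst.prodMk (mk_continuous.comp
    (Continuous.subtype_mk h3 (fun p => sh_ne (b p.1) (sphere_ne p.2))))

lemma e0_ne : (![1, 0] : Fin 2 → ℂ) ≠ 0 := fun h => by simpa using congrFun h 0
lemma aff_ne (c : ℂ) : (![c, 1] : Fin 2 → ℂ) ≠ 0 := fun h => by simpa using congrFun h 1

/-- Let `b` be a holomorphic function on a neighborhood of the closed unit disk `𝔻̄ ⊆ ℂ`
that does not vanish on `𝔻̄`, and let `g` be the homeomorphism of `𝔻̄ × ℙ¹(ℂ)` defined by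
`g(x, [y₀:y₁]) = (x, [y₀ + b(x)·y₁ : y₁])`.  For any metric on `𝔻̄ × ℙ¹(ℂ)` inducing the
product topology, `hpol g = 1`. -/
theorem hpol_parabolic_skew_product
    (b : ℂ → ℂ) (U : Set ℂ) (hU : IsOpen U) (hUD : Metric.closedBall (0 : ℂ) 1 ⊆ U)
    (hb : DifferentiableOn ℂ b U)
    (hb0 : ∀ x ∈ Metric.closedBall (0 : ℂ) 1, b x ≠ 0)
    (dm : MetricSpace ((Metric.closedBall (0 : ℂ) 1) × Projectivization ℂ (Fin 2 → ℂ)))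
    (hdm : dm.toUniformSpace.toTopologicalSpace =
      inferInstanceAs (TopologicalSpace
        ((Metric.closedBall (0 : ℂ) 1) × Projectivization ℂ (Fin 2 → ℂ)))) :
    @hpol _ dm.toPseudoMetricSpace
      (fun p : (Metric.closedBall (0 : ℂ) 1) × Projectivization ℂ (Fin 2 → ℂ) =>
        (p.1, projAction !![1, b (p.1 : ℂ); 0, 1] p.2)) = 1 := by
  have hbc : ContinuousOn b (Metric.closedBall (0 : ℂ) 1) := hb.continuousOn.mono hUD
  haveI : CompactSpace (Metric.closedBall (0 : ℂ) 1) :=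
    isCompact_iff_compactSpace.1 (isCompact_closedBall _ _)
  obtain ⟨β, hβ, hβb⟩ : ∃ β : ℝ, 0 < β ∧ ∀ x ∈ Metric.closedBall (0 : ℂ) 1, β ≤ ‖b x‖ := by
    obtain ⟨x, hx, hmin⟩ := (isCompact_closedBall (0 : ℂ) 1).exists_isMinOn
      ⟨0, by simp⟩ hbc.norm
    exact ⟨‖b x‖, norm_pos_iff.2 (hb0 x hx), fun y hy => hmin hy⟩
  have h0m : (0 : ℂ) ∈ Metric.closedBall (0 : ℂ) 1 := by simp
  refine hpol_combined dm hdm _ (g_continuous b hbc) Prod.fst continuous_fst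
    (fun x => (x, Projectivization.mk ℂ ![1, 0] e0_ne)) (by fun_prop) (fun _ => rfl)
    (fun p => hh p.2) (hh_continuous.comp continuous_snd) ?_ ?_ ?_
    (fun k => (⟨0, h0m⟩, Projectivization.mk ℂ ![-(k * b 0), 1] (aff_ne _)))
    (1 / (β + 1)) ?_ ?_ ?_
  · rintro ⟨x, y⟩
    induction y using Projectivization.ind with
    | h v hv => simp only [hh_mk]; positivity
  · rintro ⟨x, y⟩
    induction y using Projectivization.ind with
    | h v hv =>
      simp only [hh_mk]
      intro h
      rw [div_eq_zero_iff] at h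
      rcases h with h | h
      · have h1 : v 1 = 0 := norm_eq_zero.1 h
        refine Prod.ext rfl ?_
        simp only
        rw [Projectivization.mk_eq_mk_iff']
        refine ⟨v 0, ?_⟩
        ext i
        fin_cases i <;> simp [h1]
      · exact absurd h (den_pos hv).ne'
  · intro c hc
    obtain ⟨L, hL⟩ := exists_nat_gt (2 / (c * β))
    refine ⟨L, ?_⟩
    rintro ⟨x, y⟩ i hi
    induction y using Projectivization.ind with
    | h v hv =>
      rw [iter_mk]
      simp only [hh_mk]
      intro h
      have hiL : (L : ℝ) < i := by exact_mod_cast hi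
      have hi2 : 2 ≤ c * β * i := by
        have := (div_lt_iff₀ (by positivity)).1 (hL.trans hiL)
        linarith
      rw [le_div_iff₀ (den_pos hv)] at h
      rw [div_lt_iff₀ (den_pos (sh_ne _ hv))]
      simp only [sh, Matrix.cons_val_zero, Matrix.cons_val_one]
      have hpos1 : 0 < ‖v 1‖ := lt_of_lt_of_le (mul_pos hc (den_pos hv)) h
      have hx := hβb x x.2
      have e1 : (i : ℝ) * ‖b x‖ * ‖v 1‖ ≤ ‖v 0 + i * b x * v 1‖ + ‖v 0‖ := by
        have := norm_sub_le (v 0 + i * b x * v 1) (v 0)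
        simpa using this
      have e2 : (i : ℝ) * β * ‖v 1‖ ≤ i * ‖b x‖ * ‖v 1‖ := by gcongr
      have e3 := mul_le_mul_of_nonneg_left (e2.trans e1) hc.le
      have e4 := mul_le_mul_of_nonneg_right hi2 hpos1.le
      have e5 := mul_pos hc hpos1
      nlinarith
  · rw [div_lt_one (by linarith)]; linarith
  · intro k
    rw [iter_mk]
    simp [hh_mk, sh]
  · intro k l hkl
    rw [iter_mk]
    simp only [hh_mk, sh, Matrix.cons_val_zero, Matrix.cons_val_one, norm_one]
    apply one_div_le_one_div_of_le (by linarith)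
    have e : -((l : ℂ) * b 0) + k * b 0 * 1 = (((k : ℤ) - (l : ℤ) : ℤ) : ℂ) * b 0 := by
      push_cast; ring
    rw [e, norm_mul, Complex.norm_intCast]
    have h1 : (1 : ℝ) ≤ |(((k : ℤ) - (l : ℤ) : ℤ) : ℝ)| := by
      have : (1 : ℤ) ≤ |(k : ℤ) - (l : ℤ)| := Int.one_le_abs (by omega)
      exact_mod_cast this
    have := hβb 0 h0m
    nlinarith [norm_nonneg (b 0)]
end
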